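/- Let E be a smooth homogeneous cubic in S = ℂ[z₀,…,z₄] with Jacobian ideal J. For every ξ ∈ S^3 with ξ ∉ J, the subspace {q ∈ S^2 : q·ξ ∈ J} has dimension exactly 14, i.e. it is a hyperplane in the 15-dimensional space S^2. (Equivalently, the kernel K₂(ξ) of multiplication by ξ from R^2 to R^5 has dimension 9.) -/

import Mathlib

open MvPolynomial Module

noncomputable section

/-- The Jacobian ideal of a polynomial `E`, generated by its five partial derivatives. -/
def jacobianIdeal (E : MvPolynomial (Fin 5) ℂ) : Ideal (MvPolynomial (Fin 5) ℂ) :=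
  Ideal.span (Set.range fun i => pderiv i E)

/-- `E` is a smooth cubic: it is homogeneous of degree 3 and the only common zero of its
partial derivatives is the origin. -/
def IsSmoothCubic (E : MvPolynomial (Fin 5) ℂ) : Prop :=
  E.IsHomogeneous 3 ∧ ∀ x : Fin 5 → ℂ, (∀ i, eval x (pderiv i E) = 0) → x = 0

/-- `{q ∈ S² : q·ξ ∈ J}`, the space of quadrics killed by multiplication by `ξ`
in the Jacobian ring. -/
def K2preimage (E ξ : MvPolynomial (Fin 5) ℂ) : Submodule ℂ (MvPolynomial (Fin 5) ℂ) :=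
  homogeneousSubmodule (Fin 5) ℂ 2 ⊓
    Submodule.comap (LinearMap.mulRight ℂ ξ) ((jacobianIdeal E).restrictScalars ℂ)

/-- If every entry of `A *ᵥ v` lies in `I`, then so does `A.det * v j`, by Cramer's rule. -/
theorem Ideal.det_mul_mem_of_mulVec_mem {R n : Type*} [CommRing R] [Fintype n] [DecidableEq n]
    (I : Ideal R) (A : Matrix n n R) (v : n → R) (h : ∀ i, (A.mulVec v) i ∈ I) (j : n) :
    A.det * v j ∈ I := by
  have key : A.det * v j = ∑ k, A.adjugate j k * (A.mulVec v) k := by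
    have : (A.adjugate.mulVec (A.mulVec v)) j = A.det * v j := by
      rw [Matrix.mulVec_mulVec, Matrix.adjugate_mul, Matrix.smul_mulVec, Matrix.one_mulVec]
      simp
    rw [← this]
    rfl
  rw [key]
  exact I.sum_mem fun k _ => I.mul_mem_left _ (h k)

namespace MvPolynomial

variable {σ K : Type*} [Field K]

theorem mem_span_X_pow_image {s : Set σ} {N : ℕ} {p : MvPolynomial σ K} :
    p ∈ Ideal.span ((fun k => (X k : MvPolynomial σ K) ^ N) '' s) ↔
      ∀ m ∈ p.support, ∃ k ∈ s, N ≤ m k := by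
  have h := mem_ideal_span_monomial_image (x := p) (s := (fun k => Finsupp.single k N) '' s)
  rw [Set.image_image] at h
  simp only [← X_pow_eq_monomial] at h
  refine h.trans ?_
  simp

theorem mem_span_X_pow_image_of_mul_X_mem {s : Set σ} {N : ℕ} {p : MvPolynomial σ K} {i : σ}
    (hi : i ∉ s) (h : p * X i ∈ Ideal.span ((fun k => (X k : MvPolynomial σ K) ^ N) '' s)) :
    p ∈ Ideal.span ((fun k => (X k : MvPolynomial σ K) ^ N) '' s) := by
  classical
  rw [mem_span_X_pow_image] at h ⊢
  intro m hm
  obtain ⟨k, hk, hN⟩ := h (m + Finsupp.single i 1) (by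
    rw [mem_support_iff, coeff_mul_X]; exact mem_support_iff.mp hm)
  have hki : i ≠ k := fun e => hi (e ▸ hk)
  refine ⟨k, hk, ?_⟩
  simpa [Finsupp.single_apply, hki] using hN

variable [Fintype σ] [DecidableEq σ]

/-- Changing one row of a matrix `A` with `A *ᵥ X = X ^ N` does not change its determinant modulo
the ideal generated by the `X k ^ N`. -/
theorem det_updateRow_sub_det_mem {N : ℕ} (hN : N ≠ 0) (A : Matrix σ σ (MvPolynomial σ K))
    (hA : A.mulVec X = fun k => X k ^ N) (i : σ) :
    (A.updateRow i (Pi.single i (X i ^ (N - 1)))).det - A.det ∈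
      Ideal.span (Set.range fun k => (X k : MvPolynomial σ K) ^ N) := by
  set r : σ → MvPolynomial σ K := Pi.single i (X i ^ (N - 1)) with hr
  have hdet : (A.updateRow i r).det - A.det = (A.updateRow i (r - A i)).det := by
    have h := Matrix.det_updateRow_add A i (r - A i) (A i)
    rw [sub_add_cancel, Matrix.updateRow_eq_self] at h
    rw [h]; ring
  rw [hdet]
  refine Ideal.span_mono (Set.image_subset_range _ {i}ᶜ)
    (mem_span_X_pow_image_of_mul_X_mem (i := i) (by simp) ?_)
  refine Ideal.det_mul_mem_of_mulVec_mem _ _ X (fun k => ?_) i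
  by_cases hk : k = i
  · subst hk
    have h0 : ((A.updateRow k (r - A k)).mulVec X) k = 0 := by
      have h1 : A k ⬝ᵥ X = (X k : MvPolynomial σ K) ^ N := congrFun hA k
      rw [Matrix.mulVec, Matrix.updateRow_self, sub_dotProduct, h1, hr, single_dotProduct,
        ← pow_succ, Nat.sub_add_cancel (Nat.pos_of_ne_zero hN), sub_self]
    rw [h0]
    exact Ideal.zero_mem _
  · have h0 : ((A.updateRow i (r - A i)).mulVec X) k = X k ^ N := by
      rw [← congrFun hA k, Matrix.mulVec, Matrix.mulVec, Matrix.updateRow_ne hk]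
    rw [h0]
    exact Ideal.subset_span ⟨k, hk, rfl⟩

theorem det_notMem_span_X_pow {N : ℕ} (hN : N ≠ 0) (A : Matrix σ σ (MvPolynomial σ K))
    (hA : A.mulVec X = fun k => X k ^ N) :
    A.det ∉ Ideal.span (Set.range fun k => (X k : MvPolynomial σ K) ^ N) := by
  set I := Ideal.span (Set.range fun k => (X k : MvPolynomial σ K) ^ N) with hI
  let D : Matrix σ σ (MvPolynomial σ K) := Matrix.diagonal fun k => X k ^ (N - 1)
  have hD : D.mulVec X = fun k => X k ^ N := by
    ext1 k
    rw [Matrix.mulVec_diagonal, ← pow_succ, Nat.sub_add_cancel (Nat.pos_of_ne_zero hN)]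
  have key : ∀ s : Finset σ, (Matrix.of fun i => if i ∈ s then D i else A i).det - A.det ∈ I := by
    intro s
    induction s using Finset.induction_on with
    | empty =>
      have : (Matrix.of fun i => if i ∈ (∅ : Finset σ) then D i else A i) = A := by
        ext1 i; simp
      rw [this, sub_self]
      exact I.zero_mem
    | insert i s his ih =>
      set B : Matrix σ σ (MvPolynomial σ K) :=
        Matrix.of fun i => if i ∈ s then D i else A i with hB
      have hBX : B.mulVec X = fun k => X k ^ N := by
        ext1 k
        by_cases hk : k ∈ s
        · rw [← congrFun hD k]
          simp [Matrix.mulVec, hB, hk]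
        · rw [← congrFun hA k]
          simp [Matrix.mulVec, hB, hk]
      have hstep := det_updateRow_sub_det_mem hN B hBX i
      have hup : (Matrix.of fun j => if j ∈ insert i s then D j else A j) =
          B.updateRow i (Pi.single i (X i ^ (N - 1))) := by
        ext j l : 2
        by_cases hj : j = i
        · subst hj
          simp [D, Matrix.diagonal_apply, Pi.single_apply, eq_comm]
        · simp [hB, hj]
      rw [hup]
      simpa using I.add_mem hstep ih
  have hfull := key Finset.univ
  have hof : (Matrix.of fun i => if i ∈ (Finset.univ : Finset σ) then D i else A i) = D := by
    ext1 i; simp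
  rw [hof] at hfull
  intro hmem
  have hDmem : D.det ∈ I := by simpa using I.add_mem hfull hmem
  rw [hI, ← Set.image_univ, mem_span_X_pow_image] at hDmem
  have hmon : D.det = monomial (Finsupp.equivFunOnFinite.symm fun _ => N - 1) (1 : K) := by
    rw [Matrix.det_diagonal, monomial_eq, Finsupp.prod_fintype _ _ (by simp)]
    simp
  obtain ⟨k, -, hk⟩ := hDmem (Finsupp.equivFunOnFinite.symm fun _ => N - 1) (by
    rw [hmon, mem_support_iff, coeff_monomial]; simp)
  simp only [Finsupp.equivFunOnFinite_symm_apply_apply] at hk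
  omega

/-- If `f = M *ᵥ X` and the ideal generated by the entries of `f` contains a power of every
variable, then `M.det` is not in that ideal. -/
theorem det_notMem_span_of_mulVec_X {f : σ → MvPolynomial σ K}
    (M : Matrix σ σ (MvPolynomial σ K)) (hM : M.mulVec X = f)
    {N : ℕ} (hN : N ≠ 0) (hX : ∀ k, (X k : MvPolynomial σ K) ^ N ∈ Ideal.span (Set.range f)) :
    M.det ∉ Ideal.span (Set.range f) := by
  have h := fun k => Ideal.mem_span_range_iff_exists_fun.mp (hX k)
  choose B hB using h
  have hBf : (Matrix.of B).mulVec f = fun k => X k ^ N := by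
    ext1 k; exact hB k
  have hdet := det_notMem_span_X_pow hN (Matrix.of B * M)
    (by rw [← Matrix.mulVec_mulVec, hM, hBf])
  contrapose! hdet
  obtain ⟨c, hc⟩ := Ideal.mem_span_range_iff_exists_fun.mp hdet
  rw [Matrix.det_mul, ← hc, Finset.mul_sum]
  refine Ideal.sum_mem _ fun j _ => ?_
  rw [mul_left_comm]
  refine Ideal.mul_mem_left _ _ (Ideal.det_mul_mem_of_mulVec_mem _ _ f (fun k => ?_) j)
  rw [hBf]
  exact Ideal.subset_span ⟨k, rfl⟩

end MvPolynomial

namespace MvPolynomial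

variable {σ K : Type*} [Field K]

open TensorProduct

theorem aeval_map_X_tmul_one {R : Type*} [CommRing R] [Algebra K R] (π : MvPolynomial σ K →ₐ[K] R)
    (p : MvPolynomial σ K) :
    aeval (fun k => π (X k) ⊗ₜ[K] (1 : R)) p = π p ⊗ₜ[K] 1 := by
  have h : aeval (fun k => π (X k) ⊗ₜ[K] (1 : R)) =
      (Algebra.TensorProduct.includeLeft (R := K) (S := K) (A := R) (B := R)).comp π := by
    ext k; simp
  rw [h]; rfl

theorem aeval_one_tmul_map_X {R : Type*} [CommRing R] [Algebra K R] (π : MvPolynomial σ K →ₐ[K] R)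
    (p : MvPolynomial σ K) :
    aeval (fun k => (1 : R) ⊗ₜ[K] π (X k)) p = 1 ⊗ₜ[K] π p := by
  have h : aeval (fun k => (1 : R) ⊗ₜ[K] π (X k)) =
      (Algebra.TensorProduct.includeRight (R := K) (A := R) (B := R)).comp π := by
    ext k; simp
  rw [h]; rfl

variable [Fintype σ]

/-- The polarization identity for quadratic forms, in terms of partial derivatives. -/
theorem sum_aeval_add_pderiv_mul_sub_of_isHomogeneous_two {A : Type*} [CommRing A] [Algebra K A]
    {g : MvPolynomial σ K} (hg : g.IsHomogeneous 2) (x y : σ → A) :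
    ∑ j, aeval (x + y) (pderiv j g) * (x j - y j) = 2 * (aeval x g - aeval y g) := by
  classical
  rw [← mem_homogeneousSubmodule, ← homogeneousSubmodule_one_pow,
    homogeneousSubmodule_one_eq_span_X, pow_two, Submodule.span_mul_span] at hg
  induction hg using Submodule.span_induction with
  | mem p hp =>
    obtain ⟨_, ⟨a, rfl⟩, _, ⟨b, rfl⟩, rfl⟩ := hp
    simp only [Derivation.leibniz, pderiv_X, smul_eq_mul, map_add, map_mul, aeval_X, Pi.add_apply]
    simp only [Pi.single_apply, apply_ite (aeval (x + y)), map_one, map_zero, add_mul, mul_ite,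
      mul_one, mul_zero, ite_mul, zero_mul, Finset.sum_add_distrib, Finset.sum_ite_eq,
      Finset.mem_univ, if_true]
    ring
  | zero => simp
  | add p q _ _ hp hq =>
    simp only [map_add, add_mul, Finset.sum_add_distrib, hp, hq]
    ring
  | smul c p _ hp =>
    simp only [map_smul, Derivation.map_smul, smul_mul_assoc, ← Finset.smul_sum, hp, ← smul_sub,
      mul_smul_comm]

/-- Half the Jacobian matrix of the polynomials `f`; if these are quadratic forms, the matrix
multiplies the vector of variables to `f`. -/
def halfJacobianMatrix (f : σ → MvPolynomial σ K) : Matrix σ σ (MvPolynomial σ K) :=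
  Matrix.of fun i j => C (1 / 2) * pderiv j (f i)

theorem halfJacobianMatrix_mulVec_X [CharZero K] {f : σ → MvPolynomial σ K}
    (hf : ∀ i, (f i).IsHomogeneous 2) : (halfJacobianMatrix f).mulVec X = f := by
  ext1 i
  have h := (hf i).sum_X_mul_pderiv
  calc (halfJacobianMatrix f).mulVec X i
      = C (1 / 2) * ∑ j, X j * pderiv j (f i) := by
        simp only [Matrix.mulVec, dotProduct, halfJacobianMatrix, Matrix.of_apply, Finset.mul_sum]
        exact Finset.sum_congr rfl fun j _ => by ring
    _ = f i := by
        rw [h, nsmul_eq_mul, ← mul_assoc, Nat.cast_ofNat,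
          show (2 : MvPolynomial σ K) = C 2 from (map_ofNat C 2).symm, ← C_mul]
        norm_num

variable [DecidableEq σ]

theorem det_halfJacobianMatrix_isHomogeneous {f : σ → MvPolynomial σ K}
    (hf : ∀ i, (f i).IsHomogeneous 2) :
    (halfJacobianMatrix f).det.IsHomogeneous (Fintype.card σ) := by
  rw [Matrix.det_apply]
  refine IsHomogeneous.sum _ _ _ fun τ _ => ?_
  have h : (∏ i, halfJacobianMatrix f (τ i) i).IsHomogeneous (Fintype.card σ) := by
    have := IsHomogeneous.prod Finset.univ (fun i => halfJacobianMatrix f (τ i) i)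
      (fun _ => 1) fun i _ => ((hf (τ i)).pderiv (i := i)).C_mul (1 / 2 : K)
    simpa using this
  rcases Int.units_eq_one_or (Equiv.Perm.sign τ) with h1 | h1 <;> rw [h1]
  · simpa using h
  · simpa using h.neg

variable {R : Type*} [CommRing R] [Algebra K R]

/-- The Bezoutian of the quadratic forms `f`, as an element of the tensor square of an algebra `R`
under the polynomial ring. -/
def bezoutian (π : MvPolynomial σ K →ₐ[K] R) (f : σ → MvPolynomial σ K) : R ⊗[K] R :=
  (Matrix.of fun i j => aeval ((fun k => π (X k) ⊗ₜ[K] (1 : R)) + fun k => (1 : R) ⊗ₜ[K] π (X k))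
    (halfJacobianMatrix f i j)).det

/-- Contraction of the first tensor factor of the Bezoutian with a linear functional. -/
def contractBezoutian (π : MvPolynomial σ K →ₐ[K] R) (f : σ → MvPolynomial σ K) (φ : R →ₗ[K] K) :
    R :=
  TensorProduct.lid K R (φ.rTensor R (bezoutian π f))

variable {π : MvPolynomial σ K →ₐ[K] R} {f : σ → MvPolynomial σ K}

theorem bezoutian_mul_X_sub (hf : ∀ i, (f i).IsHomogeneous 2)
    (hπf : ∀ i, π (f i) = 0) (j : σ) :
    bezoutian π f * (π (X j) ⊗ₜ[K] 1 - 1 ⊗ₜ[K] π (X j)) = 0 := by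
  refine Ideal.mem_bot.mp (Ideal.det_mul_mem_of_mulVec_mem ⊥ _
    (fun k => π (X k) ⊗ₜ[K] 1 - 1 ⊗ₜ[K] π (X k)) (fun i => Ideal.mem_bot.mpr ?_) j)
  have h := sum_aeval_add_pderiv_mul_sub_of_isHomogeneous_two (hf i)
    (fun k => π (X k) ⊗ₜ[K] (1 : R)) (fun k => (1 : R) ⊗ₜ[K] π (X k))
  rw [aeval_map_X_tmul_one, aeval_one_tmul_map_X, hπf, zero_tmul, tmul_zero, sub_zero, mul_zero] at h
  simp only [Matrix.mulVec, dotProduct, Matrix.of_apply, halfJacobianMatrix, map_mul, mul_assoc,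
    ← Finset.mul_sum]
  rw [h, mul_zero]

theorem tmul_one_mul_bezoutian (hf : ∀ i, (f i).IsHomogeneous 2) (hπf : ∀ i, π (f i) = 0)
    (hπ : Function.Surjective π) (r : R) :
    (r ⊗ₜ[K] 1) * bezoutian π f = (1 ⊗ₜ[K] r) * bezoutian π f := by
  obtain ⟨p, rfl⟩ := hπ r
  rw [← aeval_map_X_tmul_one, ← aeval_one_tmul_map_X]
  induction p using MvPolynomial.induction_on with
  | C a => simp
  | add p q hp hq => simp only [map_add, add_mul, hp, hq]
  | mul_X p k hp =>
    have hk := bezoutian_mul_X_sub hf hπf k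
    simp only [map_mul, aeval_X]
    linear_combination aeval (fun k => π (X k) ⊗ₜ[K] (1 : R)) p * hk + (1 ⊗ₜ[K] π (X k)) * hp

theorem contractBezoutian_comp_mulLeft (hf : ∀ i, (f i).IsHomogeneous 2) (hπf : ∀ i, π (f i) = 0)
    (hπ : Function.Surjective π) (φ : R →ₗ[K] K) (r : R) :
    contractBezoutian π f (φ ∘ₗ LinearMap.mulLeft K r) = r * contractBezoutian π f φ := by
  have h1 : ∀ t : R ⊗[K] R,
      (φ ∘ₗ LinearMap.mulLeft K r).rTensor R t = φ.rTensor R ((r ⊗ₜ[K] 1) * t) := by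
    intro t
    induction t with
    | zero => simp
    | tmul a b => simp
    | add a b ha hb => rw [map_add, ha, hb, mul_add, map_add]
  have h2 : ∀ t : R ⊗[K] R, TensorProduct.lid K R (φ.rTensor R ((1 ⊗ₜ[K] r) * t)) =
      r * TensorProduct.lid K R (φ.rTensor R t) := by
    intro t
    induction t with
    | zero => simp
    | tmul a b => simp
    | add a b ha hb => rw [mul_add, map_add, map_add, ha, hb, map_add, map_add, mul_add]
  rw [contractBezoutian, h1, tmul_one_mul_bezoutian hf hπf hπ, h2, contractBezoutian]

theorem apply_contractBezoutian (φ : R →ₗ[K] K) (ε : R →ₐ[K] K) (hε : ∀ k, ε (π (X k)) = 0) :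
    ε (contractBezoutian π f φ) = φ (π (halfJacobianMatrix f).det) := by
  let Ψ : R ⊗[K] R →ₐ[K] R :=
    Algebra.TensorProduct.lift (AlgHom.id K R) ((Algebra.ofId K R).comp ε)
      fun _ _ => Commute.all _ _
  have hΨ : ∀ t, ε (TensorProduct.lid K R (φ.rTensor R t)) = φ (Ψ t) := by
    intro t
    induction t with
    | zero => simp
    | tmul a b =>
      simp only [LinearMap.rTensor_tmul, TensorProduct.lid_tmul, map_smul, smul_eq_mul, Ψ,
        Algebra.TensorProduct.lift_tmul, AlgHom.coe_id, id_eq, AlgHom.coe_comp,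
        Function.comp_apply, Algebra.ofId_apply]
      rw [mul_comm a, ← Algebra.smul_def, map_smul, smul_eq_mul, mul_comm]
    | add a b ha hb => simp only [map_add, ha, hb]
  have hcomp : Ψ.comp (aeval ((fun k => π (X k) ⊗ₜ[K] (1 : R)) +
      fun k => (1 : R) ⊗ₜ[K] π (X k))) = π := by
    ext k
    simp [Ψ, hε]
  rw [contractBezoutian, hΨ, bezoutian, AlgHom.map_det, AlgHom.map_det]
  congr 2
  ext i j
  exact DFunLike.congr_fun hcomp (halfJacobianMatrix f i j)

/-- Let `R` be a quotient of the polynomial ring by an ideal containing the quadratic forms `f` and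
powers of all variables. A linear functional on `R` that does not vanish on the Jacobian
determinant of `f` induces a nondegenerate pairing on `R`. -/
theorem exists_apply_mul_ne_zero (hf : ∀ i, (f i).IsHomogeneous 2) (hπf : ∀ i, π (f i) = 0)
    (hπ : Function.Surjective π) (hX : ∀ k, IsNilpotent (π (X k)))
    (ε : R →ₐ[K] K) (φ : R →ₗ[K] K) (hφ : φ (π (halfJacobianMatrix f).det) ≠ 0)
    {r : R} (hr : r ≠ 0) : ∃ s, φ (r * s) ≠ 0 := by
  have hεX : ∀ k, ε (π (X k)) = 0 := fun k => ((hX k).map ε).eq_zero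
  have hε : ∀ p, ε (π p) = constantCoeff p := fun p => by
    have : ε.comp π = aeval 0 := by ext k; simp [hεX]
    have h := DFunLike.congr_fun this p
    simpa using h
  have hu := apply_contractBezoutian (f := f) φ ε hεX
  have hunit : IsUnit (contractBezoutian π f φ) := by
    obtain ⟨g, hg⟩ := hπ (contractBezoutian π f φ)
    rw [← hg, hε] at hu
    rw [← hg, ← sub_add_cancel g (C (constantCoeff g)), map_add]
    refine IsNilpotent.isUnit_add_right_of_commute ?_ ?_ (Commute.all _ _)
    · have hmem : g - C (constantCoeff g) ∈ idealOfVars σ K := by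
        rw [← pow_one (idealOfVars σ K), mem_pow_idealOfVars_iff']
        intro d hd
        have hd0 : d = 0 := (Finsupp.degree_eq_zero_iff d).mp (Nat.lt_one_iff.mp hd)
        subst hd0
        simp [constantCoeff_eq]
      have hle : idealOfVars σ K ≤ (nilradical R).comap π := by
        rw [Ideal.span_le]
        rintro _ ⟨k, rfl⟩
        exact mem_nilradical.mpr (hX k)
      exact mem_nilradical.mp (hle hmem)
    · refine IsUnit.map π (IsUnit.map C (isUnit_iff_ne_zero.mpr ?_))
      rw [hu]; exact hφ
  by_contra! hs
  have hzero : φ ∘ₗ LinearMap.mulLeft K r = 0 := by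
    ext1 s; exact hs s
  have h := contractBezoutian_comp_mulLeft hf hπf hπ φ r
  rw [hzero] at h
  refine hr (hunit.mul_left_eq_zero.mp (h.symm.trans ?_))
  simp [contractBezoutian]

end MvPolynomial

namespace MvPolynomial

theorem homogeneousComponent_mul_of_isHomogeneous {σ R : Type*} [CommSemiring R]
    {p : MvPolynomial σ R} {m : ℕ} (hp : p.IsHomogeneous m) (q : MvPolynomial σ R) (n : ℕ) :
    homogeneousComponent (m + n) (p * q) = p * homogeneousComponent n q := by
  induction q using MvPolynomial.induction_on' with
  | monomial d a =>
    have hd : (monomial d a : MvPolynomial σ R).IsHomogeneous d.degree :=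
      isHomogeneous_monomial a rfl
    rw [homogeneousComponent_of_mem (hp.mul hd), homogeneousComponent_of_mem hd]
    by_cases h : n = d.degree <;> simp [h]
  | add q₁ q₂ h₁ h₂ => simp only [mul_add, map_add, h₁, h₂]

theorem finrank_homogeneousSubmodule (σ K : Type*) [Fintype σ] [Field K] (n : ℕ) :
    finrank K (homogeneousSubmodule σ K n) = (Fintype.card σ + n - 1).choose n := by
  classical
  have hset : {d : σ →₀ ℕ | d.degree = n} = ((Finset.univ : Finset σ).finsuppAntidiag n : Set _) := by
    ext d
    simp [Finsupp.degree_eq_sum]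
  have hspan : homogeneousSubmodule σ K n =
      Submodule.span K (Set.range fun d : {d : σ →₀ ℕ | d.degree = n} =>
        basisMonomials σ K d) := by
    rw [homogeneousSubmodule_eq_finsupp_supported, AddMonoidAlgebra.supported_eq_span_single]
    congr 1
    ext p
    simp [Set.mem_image, single_eq_monomial]
  rw [hspan]
  have hli : LinearIndependent K fun d : {d : σ →₀ ℕ | d.degree = n} => basisMonomials σ K d :=
    (basisMonomials σ K).linearIndependent.comp _ Subtype.val_injective
  have : Fintype {d : σ →₀ ℕ | d.degree = n} := hset ▸ inferInstance
  rw [finrank_span_eq_card hli, ← Nat.card_eq_fintype_card, hset]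
  exact (Nat.card_coe_set_eq _).trans ((Set.ncard_coe_finset _).trans
    (Finset.card_finsuppAntidiag_nat_eq_choose n))

end MvPolynomial

theorem IsSmoothCubic.exists_forall_X_pow_mem {E : MvPolynomial (Fin 5) ℂ}
    (hE : IsSmoothCubic E) : ∃ N ≠ 0, ∀ k, (X k : MvPolynomial (Fin 5) ℂ) ^ N ∈ jacobianIdeal E := by
  have hrad : ∀ k, (X k : MvPolynomial (Fin 5) ℂ) ∈ (jacobianIdeal E).radical := by
    intro k
    rw [← vanishingIdeal_zeroLocus_eq_radical (K := ℂ)]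
    rw [mem_vanishingIdeal_iff]
    intro x hx
    rw [mem_zeroLocus_iff] at hx
    have hx0 : x = 0 := hE.2 x fun i => by
      simpa [coe_aeval_eq_eval] using hx _ (Ideal.subset_span ⟨i, rfl⟩)
    simp [hx0]
  choose n hn using hrad
  refine ⟨∑ k, n k + 1, by omega, fun k => Ideal.pow_mem_of_pow_mem _ (hn k) ?_⟩
  have := Finset.single_le_sum (f := n) (fun _ _ => Nat.zero_le _) (Finset.mem_univ k)
  omega

theorem IsSmoothCubic.homogeneousComponent_mem {E : MvPolynomial (Fin 5) ℂ}
    (hE : IsSmoothCubic E) {p : MvPolynomial (Fin 5) ℂ} (hp : p ∈ jacobianIdeal E) (n : ℕ) :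
    homogeneousComponent n p ∈ jacobianIdeal E := by
  let := MvPolynomial.gradedAlgebra (σ := Fin 5) (R := ℂ)
  refine homogeneousComponent_mem_of_mem (Ideal.homogeneous_span _ _ ?_) hp n
  rintro _ ⟨i, rfl⟩
  exact ⟨2, hE.1.pderiv⟩

/-- Macaulay duality for the Jacobian ring of a smooth cubic threefold, whose socle lies in
degree 5. -/
theorem IsSmoothCubic.exists_nondegenerate_functional {E : MvPolynomial (Fin 5) ℂ}
    (hE : IsSmoothCubic E) :
    ∃ φ : MvPolynomial (Fin 5) ℂ →ₗ[ℂ] ℂ, (∀ p ∈ jacobianIdeal E, φ p = 0) ∧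
      (∀ p, φ (homogeneousComponent 5 p) = φ p) ∧
      ∀ p ∉ jacobianIdeal E, ∃ q, φ (p * q) ≠ 0 := by
  obtain ⟨N, hN, hX⟩ := hE.exists_forall_X_pow_mem
  let f : Fin 5 → MvPolynomial (Fin 5) ℂ := fun i => pderiv i E
  have hf : ∀ i, (f i).IsHomogeneous 2 := fun i => hE.1.pderiv
  set H := (halfJacobianMatrix f).det with hH
  have hHJ : H ∉ jacobianIdeal E :=
    det_notMem_span_of_mulVec_X _ (halfJacobianMatrix_mulVec_X hf) hN hX
  have hH5 : homogeneousComponent 5 H = H :=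
    homogeneousComponent_eq_self (det_halfJacobianMatrix_isHomogeneous hf)
  obtain ⟨ψ, hψH, hψJ⟩ := Submodule.exists_le_ker_of_notMem
    (p := (jacobianIdeal E).restrictScalars ℂ) (v := H) hHJ
  let φ : MvPolynomial (Fin 5) ℂ →ₗ[ℂ] ℂ := ψ ∘ₗ homogeneousComponent 5
  have hφJ : ∀ p ∈ jacobianIdeal E, φ p = 0 := fun p hp =>
    hψJ (hE.homogeneousComponent_mem hp 5)
  let φ' : (MvPolynomial (Fin 5) ℂ ⧸ jacobianIdeal E) →ₗ[ℂ] ℂ :=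
    (Submodule.liftQ ((jacobianIdeal E).restrictScalars ℂ) φ hφJ) ∘ₗ
      (Submodule.Quotient.restrictScalarsEquiv ℂ (jacobianIdeal E)).symm.toLinearMap
  have hφ' : ∀ p, φ' (Ideal.Quotient.mkₐ ℂ (jacobianIdeal E) p) = φ p := fun p => rfl
  have hker : ∀ a ∈ jacobianIdeal E, aeval (0 : Fin 5 → ℂ) a = 0 := by
    have hle : jacobianIdeal E ≤ RingHom.ker (aeval (0 : Fin 5 → ℂ)) := by
      refine Ideal.span_le.mpr ?_
      rintro _ ⟨i, rfl⟩
      have hc : constantCoeff (pderiv i E) = 0 := (hf i).coeff_eq_zero (d := 0) (by simp)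
      simp [hc]
    exact fun a ha => hle ha
  refine ⟨φ, hφJ, fun p => ?_, fun p hp => ?_⟩
  · exact congrArg ψ (homogeneousComponent_eq_self (homogeneousComponent_isHomogeneous 5 p))
  · obtain ⟨s, hs⟩ := exists_apply_mul_ne_zero (π := Ideal.Quotient.mkₐ ℂ (jacobianIdeal E)) hf
      (fun i => Ideal.Quotient.eq_zero_iff_mem.mpr (Ideal.subset_span ⟨i, rfl⟩))
      (Ideal.Quotient.mkₐ_surjective ℂ _)
      (fun k => ⟨N, by
        rw [← map_pow]; exact Ideal.Quotient.eq_zero_iff_mem.mpr (hX k)⟩)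
      (Ideal.Quotient.liftₐ _ (aeval (0 : Fin 5 → ℂ)) hker) φ'
      (by
        rw [hφ', ← hH]
        change ψ (homogeneousComponent 5 H) ≠ 0
        rwa [hH5])
      (r := Ideal.Quotient.mkₐ ℂ (jacobianIdeal E) p)
      (fun h => hp (Ideal.Quotient.eq_zero_iff_mem.mp h))
    obtain ⟨q, rfl⟩ := Ideal.Quotient.mkₐ_surjective ℂ _ s
    rw [← map_mul, hφ'] at hs
    exact ⟨q, hs⟩

/-- For a smooth cubic `E` and `ξ ∈ S³ \ J`, the space `{q ∈ S² : q·ξ ∈ J}` is a hyperplane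
of the 15-dimensional space `S²`, i.e. has dimension exactly 14 (equivalently `K₂(ξ) ⊂ R²`
has dimension 9). -/
theorem statement3 (E : MvPolynomial (Fin 5) ℂ) (hE : IsSmoothCubic E)
    (ξ : MvPolynomial (Fin 5) ℂ) (hξ3 : ξ.IsHomogeneous 3) (hξ : ξ ∉ jacobianIdeal E) :
    finrank ℂ (K2preimage E ξ) = 14 := by
  obtain ⟨φ, hφJ, hφ5, hφ⟩ := hE.exists_nondegenerate_functional
  have hmem : ∀ p : MvPolynomial (Fin 5) ℂ, p.IsHomogeneous 5 → φ p = 0 → p ∈ jacobianIdeal E := by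
    intro p hp h0
    by_contra hpJ
    obtain ⟨q, hq⟩ := hφ p hpJ
    refine hq ?_
    rw [← hφ5, homogeneousComponent_mul_of_isHomogeneous hp q 0, homogeneousComponent_zero,
      mul_comm, ← smul_eq_C_mul, map_smul, h0, smul_zero]
  let g : Dual ℂ (homogeneousSubmodule (Fin 5) ℂ 2) :=
    φ ∘ₗ LinearMap.mulRight ℂ ξ ∘ₗ (homogeneousSubmodule (Fin 5) ℂ 2).subtype
  have hg : g ≠ 0 := by
    obtain ⟨q, hq⟩ := hφ ξ hξ
    intro h
    refine hq ?_
    rw [← hφ5, homogeneousComponent_mul_of_isHomogeneous hξ3 q 2, mul_comm]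
    exact LinearMap.congr_fun h ⟨homogeneousComponent 2 q, homogeneousComponent_isHomogeneous 2 q⟩
  have hK : K2preimage E ξ = (LinearMap.ker g).map (homogeneousSubmodule (Fin 5) ℂ 2).subtype := by
    ext q
    constructor
    · rintro ⟨hq2, hqJ⟩
      exact ⟨⟨q, hq2⟩, hφJ _ hqJ, rfl⟩
    · rintro ⟨⟨q, hq2⟩, hq, rfl⟩
      exact ⟨hq2, hmem _ (IsHomogeneous.mul hq2 hξ3) hq⟩
  have hdim := finrank_homogeneousSubmodule (Fin 5) ℂ 2
  have : FiniteDimensional ℂ (homogeneousSubmodule (Fin 5) ℂ 2) :=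
    Module.Finite.iff_fg.mpr (homogeneousSubmodule_fg (Fin 5) ℂ 2)
  have hker := Dual.finrank_ker_add_one_of_ne_zero hg
  rw [hdim] at hker
  rw [hK, Submodule.finrank_map_subtype_eq]
  simpa [Nat.choose] using hker
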